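/- Let A be an associative ring and T a left A-module satisfying: (i) T has projective dimension at most n, (ii) Ext^i_A(T, T^{(I)}) = 0 for all i > 0 and all sets I, and (3) every left A-module X admits an epimorphism L → X from a module L having a finite coresolution 0 → L → T^0 → ⋯ → T^n → 0 with T^j ∈ Add(T). Then the free module A admits an exact sequence 0 → A → T^0 → ⋯ → T^n → 0 with all T^j ∈ Add(T); i.e., T is an n-tilting module in the classical sense. -/

import Mathlib

open CategoryTheory Limits

universe w u

/-- `X` is a direct summand of a (possibly infinite) direct sum of copies of `T`. -/
def InAdd {A : Type u} [Ring A] (T X : ModuleCat.{u} A) : Prop :=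
  ∃ (ι : Type u) (Y : ModuleCat.{u} A),
    Nonempty ((X ⊞ Y) ≅ ∐ (fun _ : ι => T))

/-- `L ∈ L_m`: there is an exact sequence `0 → L → T^0 → ⋯ → T^m → 0` of
`A`-modules with all `T^j ∈ Add(T)` (encoded by an `ℕ`-indexed sequence
vanishing in degrees `> m`). -/
def InLm {A : Type u} [Ring A] (T : ModuleCat.{u} A) (m : ℕ)
    (L : ModuleCat.{u} A) : Prop :=
  ∃ (E : ℕ → ModuleCat.{u} A) (f : L ⟶ E 0) (d : ∀ i : ℕ, E i ⟶ E (i + 1))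
    (hw0 : f ≫ d 0 = 0) (hw : ∀ i : ℕ, d i ≫ d (i + 1) = 0),
    (∀ i : ℕ, i ≤ m → InAdd T (E i)) ∧
    (∀ i : ℕ, m < i → IsZero (E i)) ∧
    Mono f ∧
    (ShortComplex.mk f (d 0) hw0).Exact ∧
    (∀ i : ℕ, (ShortComplex.mk (d i) (d (i + 1)) (hw i)).Exact)

namespace CategoryTheory

open Abelian

section Abelian

variable {C : Type*} [Category* C] [Abelian C]

/-- `FinCores P L`: the object `L` has a finite coresolution by objects satisfying `P`. -/
inductive FinCores (P : ObjectProperty C) : C → Prop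
  | zero (L : C) (hL : IsZero L) : FinCores P L
  | step (S : ShortComplex C) (hS : S.ShortExact) (h₂ : P S.X₂) (h₃ : FinCores P S.X₃) :
      FinCores P S.X₁

namespace FinCores

variable {P : ObjectProperty C}

lemma of_shortExact {L X L' : C} {f : L ⟶ X} {g : X ⟶ L'} {w : f ≫ g = 0}
    (h : (ShortComplex.mk f g w).ShortExact) (hX : P X) (hL' : FinCores P L') : FinCores P L :=
  step _ h hX hL'

lemma of_iso {L M : C} (e : L ≅ M) (hL : FinCores P L) : FinCores P M := by
  cases hL with
  | zero _ h => exact zero _ (h.of_iso e.symm)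
  | step S hS h₂ h₃ =>
    refine of_shortExact (f := e.inv ≫ S.f) (g := S.g) (w := by simp) ?_ h₂ h₃
    exact ShortComplex.shortExact_of_iso
      (ShortComplex.isoMk e (Iso.refl _) (Iso.refl _) (by simp) (by simp)) hS

end FinCores

/-- The `3 × 3` lemma in the form needed for the dual horseshoe lemma. -/
lemma shortExact_cokernel_biprod_lift {S S₁ S₃ : ShortComplex C} (hS : S.ShortExact)
    (h₁ : S₁.ShortExact) (h₃ : S₃.ShortExact) (a : S.X₁ ≅ S₁.X₁) (b : S.X₃ ≅ S₃.X₁)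
    (φ : S.X₂ ⟶ S₁.X₂) (hφ : S.f ≫ φ = a.hom ≫ S₁.f) :
    Mono (biprod.lift φ (S.g ≫ b.hom ≫ S₃.f)) ∧
      ∃ (u : S₁.X₃ ⟶ cokernel (biprod.lift φ (S.g ≫ b.hom ≫ S₃.f)))
        (v : cokernel (biprod.lift φ (S.g ≫ b.hom ≫ S₃.f)) ⟶ S₃.X₃) (w : u ≫ v = 0),
        (ShortComplex.mk u v w).ShortExact := by
  have := hS.mono_f
  have := hS.epi_g
  have := h₁.mono_f
  have := h₁.epi_g
  have := h₃.mono_f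
  have := h₃.epi_g
  set ψ := biprod.lift φ (S.g ≫ b.hom ≫ S₃.f) with hψ
  have hψ₁ : ψ ≫ biprod.fst = φ := by simp [hψ]
  have hψ₂ : ψ ≫ biprod.snd = S.g ≫ b.hom ≫ S₃.f := by simp [hψ]
  have hfψ : S.f ≫ ψ = a.hom ≫ S₁.f ≫ biprod.inl := by
    apply biprod.hom_ext <;> simp [hψ₁, hψ₂, hφ]
  have hlift {A : C} (m : A ⟶ S.X₂) (hm : m ≫ ψ ≫ biprod.snd = 0) :
      ∃ l : A ⟶ S.X₁, l ≫ S.f = m := by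
    have hm' : m ≫ S.g = 0 := by
      rw [hψ₂] at hm
      rw [← cancel_mono (b.hom ≫ S₃.f)]
      simpa using hm
    exact ⟨hS.exact.lift m hm', hS.exact.lift_f _ _⟩
  have hu : S₁.f ≫ biprod.inl ≫ cokernel.π ψ = 0 := by
    rw [← cancel_epi a.hom]
    simpa using hfψ.symm =≫ cokernel.π ψ
  have hv : ψ ≫ biprod.snd ≫ S₃.g = 0 := by
    rw [reassoc_of% hψ₂]; simp
  let u := h₁.exact.desc (biprod.inl ≫ cokernel.π ψ) hu
  have hgu : S₁.g ≫ u = biprod.inl ≫ cokernel.π ψ := h₁.exact.g_desc _ _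
  let v := cokernel.desc ψ (biprod.snd ≫ S₃.g) hv
  have hπv : cokernel.π ψ ≫ v = biprod.snd ≫ S₃.g := cokernel.π_desc _ _ _
  have w : u ≫ v = 0 := by
    rw [← cancel_epi S₁.g, reassoc_of% hgu, hπv]; simp
  have hψ_exact := ShortComplex.exact_cokernel ψ
  refine ⟨Preadditive.mono_of_cancel_zero _ fun m hm ↦ ?_, u, v, w, ?_⟩
  · obtain ⟨l, rfl⟩ := hlift m (by rw [reassoc_of% hm, zero_comp])
    rw [Category.assoc, hfψ] at hm
    have : l = 0 := by
      rw [← cancel_mono (a.hom ≫ S₁.f ≫ biprod.inl (Y := S₃.X₂)), hm, zero_comp]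
    rw [this, zero_comp]
  have : Mono u := by
    refine Preadditive.mono_of_cancel_zero _ fun x hx ↦ ?_
    obtain ⟨A', π, _, y, hy⟩ := surjective_up_to_refinements_of_epi S₁.g x
    obtain ⟨A'', π', _, m, hm⟩ := hψ_exact.exact_up_to_refinements (y ≫ biprod.inl)
      (by simp [← hgu, ← reassoc_of% hy, hx])
    dsimp at hm
    obtain ⟨l, rfl⟩ := hlift m (by simp [← reassoc_of% hm])
    rw [Category.assoc, hfψ] at hm
    have hm' := hm =≫ biprod.fst
    simp only [Category.assoc, biprod.inl_fst, Category.comp_id] at hm'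
    rw [← cancel_epi π, ← cancel_epi π', hy, reassoc_of% hm']
    simp
  have : Epi v := by
    have : Epi (cokernel.π ψ ≫ v) := by rw [hπv]; infer_instance
    exact epi_of_epi (cokernel.π ψ) v
  refine { exact := ?_, mono_f := ‹_›, epi_g := ‹_› }
  rw [ShortComplex.exact_iff_exact_up_to_refinements]
  intro A p hp
  dsimp at p hp
  obtain ⟨A₁, π₁, _, q, hq⟩ := surjective_up_to_refinements_of_epi (cokernel.π ψ) p
  have hq' : (q ≫ biprod.snd) ≫ S₃.g = 0 := by
    rw [Category.assoc, ← hπv, ← reassoc_of% hq, hp, comp_zero]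
  let k : A₁ ⟶ S₃.X₁ := h₃.exact.lift _ hq'
  have hk : k ≫ S₃.f = q ≫ biprod.snd := h₃.exact.lift_f _ _
  obtain ⟨A₂, π₂, _, m, hm⟩ := surjective_up_to_refinements_of_epi S.g (k ≫ b.inv)
  refine ⟨A₂, π₂ ≫ π₁, inferInstance, (π₂ ≫ q ≫ biprod.fst - m ≫ φ) ≫ S₁.g, ?_⟩
  have key : π₂ ≫ q - m ≫ ψ = (π₂ ≫ q ≫ biprod.fst - m ≫ φ) ≫ biprod.inl := by
    apply biprod.hom_ext
    · simp [hψ₁]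
    · simp [hψ₂, ← reassoc_of% hm, hk]
  have := key =≫ cokernel.π ψ
  simp only [Preadditive.sub_comp, Category.assoc, cokernel.condition, comp_zero, sub_zero] at this
  simp [hgu, hq, this]

/-- If `X` is a retract of `L` and `0 ⟶ L ⟶ E ⟶ L' ⟶ 0` is exact, then the cokernel `Q` of
`X ⟶ L ⟶ E` fits into a short exact sequence `0 ⟶ L ⟶ Q ⊞ X ⟶ L' ⟶ 0`. -/
lemma Retract.shortExact_cokernel_biprod {S : ShortComplex C} (hS : S.ShortExact) {X : C}
    (h : Retract X S.X₁) :
    ∃ (u : S.X₁ ⟶ cokernel (h.i ≫ S.f) ⊞ X) (v : cokernel (h.i ≫ S.f) ⊞ X ⟶ S.X₃)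
      (w : u ≫ v = 0), (ShortComplex.mk u v w).ShortExact := by
  have := hS.mono_f
  have := hS.epi_g
  let p := cokernel.π (h.i ≫ S.f)
  have hp := ShortComplex.exact_cokernel (h.i ≫ S.f)
  let q : cokernel (h.i ≫ S.f) ⟶ S.X₃ := cokernel.desc _ S.g (by simp)
  have hpq : p ≫ q = S.g := cokernel.π_desc _ _ _
  let u : S.X₁ ⟶ cokernel (h.i ≫ S.f) ⊞ X := biprod.lift (S.f ≫ p) h.r
  have hu₁ : u ≫ biprod.fst = S.f ≫ p := by simp [u]
  have hu₂ : u ≫ biprod.snd = h.r := by simp [u]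
  have : Epi q := by
    have : Epi (p ≫ q) := by rw [hpq]; infer_instance
    exact epi_of_epi p q
  have : Mono u := by
    refine Preadditive.mono_of_cancel_zero _ fun l hl ↦ ?_
    have h₁ : l ≫ S.f ≫ p = 0 := by rw [← hu₁, reassoc_of% hl, zero_comp]
    have h₂ : l ≫ h.r = 0 := by rw [← hu₂, reassoc_of% hl, zero_comp]
    obtain ⟨A', π, _, z, hz⟩ := hp.exact_up_to_refinements (l ≫ S.f) (by simpa using h₁)
    dsimp at hz
    simp only [← Category.assoc, cancel_mono] at hz
    have hz' := hz =≫ h.r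
    simp only [Category.assoc, h.retract, h₂, comp_zero, Category.comp_id] at hz'
    rw [← cancel_epi π, hz, ← hz', zero_comp, comp_zero]
  refine ⟨u, biprod.fst ≫ q, by rw [reassoc_of% hu₁, hpq, S.zero],
    { exact := ?_, mono_f := ‹_›, epi_g := by dsimp; infer_instance }⟩
  rw [ShortComplex.exact_iff_exact_up_to_refinements]
  intro A c hc
  dsimp at c hc
  obtain ⟨A₁, π₁, _, t, ht⟩ := surjective_up_to_refinements_of_epi p (c ≫ biprod.fst)
  have ht' : t ≫ S.g = 0 := by
    rw [← hpq, ← reassoc_of% ht, hc, comp_zero]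
  let l : A₁ ⟶ S.X₁ := hS.exact.lift t ht'
  have hl : l ≫ S.f = t := hS.exact.lift_f _ _
  have hp₀ : h.i ≫ S.f ≫ p = 0 := by
    rw [← Category.assoc]; exact cokernel.condition _
  refine ⟨A₁, π₁, inferInstance, l - l ≫ h.r ≫ h.i + π₁ ≫ c ≫ biprod.snd ≫ h.i, ?_⟩
  apply biprod.hom_ext
  · simp [hu₁, hp₀, ht, reassoc_of% hl]
  · simp [hu₂]

variable [HasExt C]

namespace Retract

lemma subsingleton_ext_left {X Y : C} (h : Retract X Y) (Z : C) (i : ℕ)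
    [Subsingleton (Ext Y Z i)] : Subsingleton (Ext X Z i) := by
  refine subsingleton_of_forall_eq 0 fun x ↦ ?_
  have := Subsingleton.elim ((Ext.mk₀ h.r).comp x (zero_add i)) 0
  simpa using congrArg (fun y ↦ (Ext.mk₀ h.i).comp y (zero_add i)) this

lemma subsingleton_ext_right {X Y : C} (h : Retract X Y) (Z : C) (i : ℕ)
    [Subsingleton (Ext Z Y i)] : Subsingleton (Ext Z X i) := by
  refine subsingleton_of_forall_eq 0 fun x ↦ ?_
  have := Subsingleton.elim (x.comp (Ext.mk₀ h.i) (add_zero i)) 0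
  simpa using congrArg (fun y ↦ y.comp (Ext.mk₀ h.r) (add_zero i)) this

end Retract

namespace ShortComplex.ShortExact

variable {S : ShortComplex C} (hS : S.ShortExact)

include hS

lemma exists_extension {Y : C} [Subsingleton (Ext S.X₃ Y 1)] (φ : S.X₁ ⟶ Y) :
    ∃ φ' : S.X₂ ⟶ Y, S.f ≫ φ' = φ := by
  obtain ⟨x, hx⟩ := Ext.contravariant_sequence_exact₁ hS Y (Ext.mk₀ φ) (add_zero 1)
    (Subsingleton.elim _ _)
  obtain ⟨φ', rfl⟩ := (Ext.mk₀_bijective _ _).2 x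
  exact ⟨φ', (Ext.mk₀_bijective _ _).1 (by simpa using hx)⟩

lemma subsingleton_ext_X₁_left (Y : C) (i : ℕ) [Subsingleton (Ext S.X₂ Y i)]
    [Subsingleton (Ext S.X₃ Y (i + 1))] : Subsingleton (Ext S.X₁ Y i) := by
  refine subsingleton_of_forall_eq 0 fun x ↦ ?_
  obtain ⟨y, rfl⟩ := Ext.contravariant_sequence_exact₁ hS Y x (add_comm 1 i)
    (Subsingleton.elim _ _)
  rw [Subsingleton.elim y 0, Ext.comp_zero]

lemma subsingleton_ext_X₃_right (X : C) (i : ℕ) [Subsingleton (Ext X S.X₂ i)]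
    [Subsingleton (Ext X S.X₁ (i + 1))] : Subsingleton (Ext X S.X₃ i) := by
  refine subsingleton_of_forall_eq 0 fun x ↦ ?_
  obtain ⟨y, rfl⟩ := Ext.covariant_sequence_exact₃ X hS x rfl (Subsingleton.elim _ _)
  rw [Subsingleton.elim y 0, Ext.zero_comp]

lemma subsingleton_ext_X₁_right (X : C) (i : ℕ) [Subsingleton (Ext X S.X₃ i)]
    [Subsingleton (Ext X S.X₂ (i + 1))] : Subsingleton (Ext X S.X₁ (i + 1)) := by
  refine subsingleton_of_forall_eq 0 fun x ↦ ?_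
  obtain ⟨y, rfl⟩ := Ext.covariant_sequence_exact₁ X hS x (Subsingleton.elim _ _) rfl
  rw [Subsingleton.elim y 0, Ext.zero_comp]

end ShortComplex.ShortExact

/-- The vanishing of `Ext` groups in positive degree passes from an object to its coproducts. -/
lemma subsingleton_ext_sigma [EnoughInjectives C] {ι : Type*} (T : C)
    [HasCoproduct fun _ : ι ↦ T] (i : ℕ) (E : C) [Subsingleton (Ext T E (i + 1))] :
    Subsingleton (Ext (∐ fun _ : ι ↦ T) E (i + 1)) := by
  induction i generalizing E with
  | zero =>
    let S := ShortComplex.mk _ _ (cokernel.condition (Injective.ι E))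
    have hS : S.ShortExact :=
      { exact := ShortComplex.exact_cokernel _
        mono_f := by dsimp [S]; infer_instance
        epi_g := by dsimp [S]; infer_instance }
    have lift (f : T ⟶ S.X₃) : ∃ g : T ⟶ S.X₂, g ≫ S.g = f := by
      have : Subsingleton (Ext T S.X₁ (0 + 1)) := ‹_›
      obtain ⟨y, hy⟩ := Ext.covariant_sequence_exact₃ T hS (Ext.mk₀ f) rfl
        (Subsingleton.elim _ _)
      obtain ⟨g, rfl⟩ := (Ext.mk₀_bijective _ _).2 y
      exact ⟨g, (Ext.mk₀_bijective _ _).1 (by simpa using hy)⟩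
    refine subsingleton_of_forall_eq 0 fun x ↦ ?_
    have : Injective S.X₂ := by dsimp [S]; infer_instance
    have := Ext.subsingleton_of_injective (∐ fun _ : ι ↦ T) S.X₂ 0
    obtain ⟨y, hy⟩ := Ext.covariant_sequence_exact₁ (∐ fun _ : ι ↦ T) hS x
      (Subsingleton.elim _ _) rfl
    obtain ⟨f, rfl⟩ := (Ext.mk₀_bijective _ _).2 y
    choose g hg using fun j : ι ↦ lift (Limits.Sigma.ι (fun _ : ι ↦ T) j ≫ f)
    have hf : Limits.Sigma.desc g ≫ S.g = f := Limits.Sigma.hom_ext _ _ fun j ↦ by simp [hg]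
    rw [← hy, ← hf, ← Ext.mk₀_comp_mk₀, Ext.comp_assoc_of_second_deg_zero, hS.comp_extClass,
      Ext.comp_zero]
  | succ i ih =>
    let S := ShortComplex.mk _ _ (cokernel.condition (Injective.ι E))
    have hS : S.ShortExact :=
      { exact := ShortComplex.exact_cokernel _
        mono_f := by dsimp [S]; infer_instance
        epi_g := by dsimp [S]; infer_instance }
    have : Injective S.X₂ := by dsimp [S]; infer_instance
    have := Ext.subsingleton_of_injective T S.X₂
    have := Ext.subsingleton_of_injective (∐ fun _ : ι ↦ T) S.X₂
    have : Subsingleton (Ext T S.X₁ (i + 1 + 1)) := ‹_›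
    have := hS.subsingleton_ext_X₃_right T (i + 1)
    have := ih S.X₃
    exact hS.subsingleton_ext_X₁_right _ (i + 1)

namespace FinCores

variable {P : ObjectProperty C}

lemma subsingleton_ext {L : C} (hL : FinCores P L) {E : C}
    (hE : ∀ X, P X → ∀ i : ℕ, Subsingleton (Ext X E (i + 1))) (i : ℕ) :
    Subsingleton (Ext L E (i + 1)) := by
  induction hL generalizing i with
  | zero L hL =>
    refine subsingleton_of_forall_eq 0 fun x ↦ ?_
    rw [← Ext.mk₀_id_comp x, hL.eq_of_src (𝟙 L) 0, Ext.mk₀_zero, Ext.zero_comp]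
  | step S hS h₂ h₃ ih =>
    have := hE _ h₂ i
    have := ih (i + 1)
    exact hS.subsingleton_ext_X₁_left E (i + 1)

/-- The dual horseshoe lemma: finite coresolutions are closed under extensions. -/
lemma extension (hP : ∀ X Y, P X → P Y → P (X ⊞ Y))
    (hext : ∀ X Y, P X → P Y → ∀ i : ℕ, Subsingleton (Ext X Y (i + 1)))
    {S : ShortComplex C} (hS : S.ShortExact) (h₁ : FinCores P S.X₁) (h₃ : FinCores P S.X₃) :
    FinCores P S.X₂ := by
  suffices ∀ L : C, FinCores P L → ∀ (S : ShortComplex C), S.ShortExact → (L ≅ S.X₁) →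
      FinCores P S.X₃ → FinCores P S.X₂ from this _ h₁ S hS (Iso.refl _) h₃
  clear! S
  intro L hL
  induction hL with
  | zero L hL =>
    intro S hS e h₃
    have := hS.isIso_g_iff.2 (hL.of_iso e.symm)
    exact h₃.of_iso (asIso S.g).symm
  | step S₁ hS₁ h₁ _ ih =>
    intro S hS e h₃
    have h₃' := h₃
    generalize hN : S.X₃ = N at h₃'
    cases h₃' with
    | zero _ hN' =>
      subst hN
      have := hS.isIso_f_iff.2 hN'
      exact (step S₁ hS₁ h₁ ‹_›).of_iso (e ≪≫ asIso S.f)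
    | step S₃ hS₃ h₂ h₃' =>
      have := h₃.subsingleton_ext (fun X hX ↦ hext X _ hX h₁) 0
      obtain ⟨φ, hφ⟩ := hS.exists_extension (e.inv ≫ S₁.f)
      obtain ⟨_, u, v, w, h⟩ := shortExact_cokernel_biprod_lift hS hS₁ hS₃ e.symm
        (eqToIso hN) φ hφ
      refine of_shortExact (w := cokernel.condition _) ?_ (hP _ _ h₁ h₂)
        (ih _ h (Iso.refl _) h₃')
      exact { exact := ShortComplex.exact_cokernel _ }

/-- A retract of an object with a finite coresolution embeds into an object satisfying `P`,
with cokernel again a retract of an object with a finite coresolution. -/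
lemma exists_shortExact_of_retract (hP₀ : ∀ X, IsZero X → P X)
    (hP : ∀ X Y, P X → P Y → P (X ⊞ Y))
    (hext : ∀ X Y, P X → P Y → ∀ i : ℕ, Subsingleton (Ext X Y (i + 1)))
    {L X : C} (hL : FinCores P L) (h : Retract X L) :
    ∃ (S : ShortComplex C) (_ : S.ShortExact) (_ : S.X₁ = X) (L' : C),
      P S.X₂ ∧ FinCores P L' ∧ Nonempty (Retract S.X₃ L') := by
  have hL' := hL
  cases hL with
  | zero _ hL =>
    have hX : IsZero X := hL.of_mono h.i
    refine ⟨ShortComplex.mk (𝟙 X) (𝟙 X) (hX.eq_of_src _ _), ?_, rfl, X, hP₀ _ hX,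
      zero _ hX, ⟨.refl X⟩⟩
    exact { exact := ShortComplex.exact_of_isZero_X₂ _ hX
            mono_f := by dsimp; infer_instance
            epi_g := by dsimp; infer_instance }
  | step S hS h₂ h₃ =>
    have := hS.mono_f
    obtain ⟨u, v, w, huv⟩ := h.shortExact_cokernel_biprod hS
    refine ⟨ShortComplex.mk (h.i ≫ S.f) _ (cokernel.condition _), ?_, rfl, _, h₂,
      extension hP hext huv hL' h₃, ⟨{ i := biprod.inl, r := biprod.fst }⟩⟩
    exact { exact := ShortComplex.exact_cokernel _
            mono_f := by dsimp; infer_instance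
            epi_g := by dsimp; infer_instance }

end FinCores

end Abelian

end CategoryTheory

open Abelian

section InAdd

variable {A : Type u} [Ring A] {T : ModuleCat.{u} A}

lemma inAdd_iff {X : ModuleCat.{u} A} :
    InAdd T X ↔ ∃ ι : Type u, Nonempty (Retract X (∐ fun _ : ι ↦ T)) := by
  refine ⟨fun ⟨ι, Y, ⟨e⟩⟩ ↦ ⟨ι, ⟨.trans { i := biprod.inl, r := biprod.fst } (.ofIso e)⟩⟩,
    fun ⟨ι, ⟨h⟩⟩ ↦ ⟨ι, cokernel h.i, ⟨?_⟩⟩⟩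
  exact (ShortComplex.Splitting.ofExactOfRetraction
    (ShortComplex.mk h.i _ (cokernel.condition _)) (ShortComplex.exact_cokernel _) h.r
    h.retract (by dsimp; infer_instance)).isoBinaryBiproduct.symm

lemma InAdd.of_retract {X Y : ModuleCat.{u} A} (h : Retract X Y) (hY : InAdd T Y) :
    InAdd T X := by
  obtain ⟨ι, ⟨h'⟩⟩ := inAdd_iff.1 hY
  exact inAdd_iff.2 ⟨ι, ⟨h.trans h'⟩⟩

lemma InAdd.of_isZero {X : ModuleCat.{u} A} (hX : IsZero X) : InAdd T X :=
  inAdd_iff.2 ⟨PUnit, ⟨{ i := 0, r := 0, retract := hX.eq_of_src _ _ }⟩⟩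

lemma InAdd.biprod {X Y : ModuleCat.{u} A} (hX : InAdd T X) (hY : InAdd T Y) :
    InAdd T (X ⊞ Y) := by
  obtain ⟨ι, ⟨h⟩⟩ := inAdd_iff.1 hX
  obtain ⟨κ, ⟨h'⟩⟩ := inAdd_iff.1 hY
  let t (j : ι ⊕ κ) := Sigma.ι (fun _ : ι ⊕ κ ↦ T) j
  let i₁ : (∐ fun _ : ι ↦ T) ⟶ ∐ fun _ : ι ⊕ κ ↦ T := Sigma.desc fun j ↦ t (.inl j)
  let i₂ : (∐ fun _ : κ ↦ T) ⟶ ∐ fun _ : ι ⊕ κ ↦ T := Sigma.desc fun j ↦ t (.inr j)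
  let r₁ : (∐ fun _ : ι ⊕ κ ↦ T) ⟶ ∐ fun _ : ι ↦ T :=
    Sigma.desc (Sum.rec (fun j ↦ Sigma.ι (fun _ : ι ↦ T) j) fun _ ↦ 0)
  let r₂ : (∐ fun _ : ι ⊕ κ ↦ T) ⟶ ∐ fun _ : κ ↦ T :=
    Sigma.desc (Sum.rec (fun _ ↦ 0) fun j ↦ Sigma.ι (fun _ : κ ↦ T) j)
  have h₁₁ : i₁ ≫ r₁ = 𝟙 _ := Sigma.hom_ext _ _ fun j ↦ by simp [i₁, r₁, t]
  have h₁₂ : i₁ ≫ r₂ = 0 := Sigma.hom_ext _ _ fun j ↦ by simp [i₁, r₂, t]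
  have h₂₁ : i₂ ≫ r₁ = 0 := Sigma.hom_ext _ _ fun j ↦ by simp [i₂, r₁, t]
  have h₂₂ : i₂ ≫ r₂ = 𝟙 _ := Sigma.hom_ext _ _ fun j ↦ by simp [i₂, r₂, t]
  refine inAdd_iff.2 ⟨ι ⊕ κ, ⟨{
    i := biprod.desc (h.i ≫ i₁) (h'.i ≫ i₂)
    r := biprod.lift (r₁ ≫ h.r) (r₂ ≫ h'.r)
    retract := ?_ }⟩⟩
  apply biprod.hom_ext' <;> apply biprod.hom_ext <;>
    simp [reassoc_of% h₁₁, reassoc_of% h₁₂, reassoc_of% h₂₁, reassoc_of% h₂₂]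

lemma InAdd.subsingleton_ext [HasExt.{w} (ModuleCat.{u} A)] {X E : ModuleCat.{u} A}
    (hX : InAdd T X) (i : ℕ) [Subsingleton (Ext T E (i + 1))] :
    Subsingleton (Ext X E (i + 1)) := by
  obtain ⟨ι, ⟨h⟩⟩ := inAdd_iff.1 hX
  have := subsingleton_ext_sigma (ι := ι) T i E
  exact h.subsingleton_ext_left E (i + 1)

end InAdd

section InLm

variable {A : Type u} [Ring A] {T : ModuleCat.{u} A}

lemma finCores_of_exact (m : ℕ) {L : ModuleCat.{u} A} (E : ℕ → ModuleCat.{u} A) (f : L ⟶ E 0)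
    (d : ∀ i : ℕ, E i ⟶ E (i + 1)) (hw0 : f ≫ d 0 = 0) (hw : ∀ i : ℕ, d i ≫ d (i + 1) = 0)
    (hE : ∀ i : ℕ, i < m → InAdd T (E i)) (hE₀ : ∀ i : ℕ, m ≤ i → IsZero (E i)) (hf : Mono f)
    (h₀ : (ShortComplex.mk f (d 0) hw0).Exact)
    (hd : ∀ i : ℕ, (ShortComplex.mk (d i) (d (i + 1)) (hw i)).Exact) :
    FinCores (InAdd T) L := by
  induction m generalizing L E with
  | zero => exact .zero _ ((hE₀ 0 le_rfl).of_mono f)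
  | succ m ih =>
    refine .of_shortExact (w := cokernel.condition f) { exact := ShortComplex.exact_cokernel f }
      (hE 0 m.succ_pos) ?_
    have hw' : cokernel.desc f (d 0) hw0 ≫ d 1 = 0 := by
      rw [← cancel_epi (cokernel.π f)]; simpa using hw 0
    refine ih (fun i ↦ E (i + 1)) (cokernel.desc f (d 0) hw0) (fun i ↦ d (i + 1)) hw'
      (fun i ↦ hw (i + 1)) (fun i hi ↦ hE _ (by lia)) (fun i hi ↦ hE₀ _ (by lia))
      h₀.mono_cokernelDesc ?_ (fun i ↦ hd (i + 1))
    let φ : ShortComplex.mk (d 0) (d 1) (hw 0) ⟶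
        ShortComplex.mk (cokernel.desc f (d 0) hw0) (d 1) hw' :=
      { τ₁ := cokernel.π f, τ₂ := 𝟙 _, τ₃ := 𝟙 _ }
    have : Epi φ.τ₁ := by dsimp [φ]; infer_instance
    have : IsIso φ.τ₂ := by dsimp [φ]; infer_instance
    have : Mono φ.τ₃ := by dsimp [φ]; infer_instance
    exact (ShortComplex.exact_iff_of_epi_of_isIso_of_mono φ).1 (hd 0)

lemma InLm.finCores {m : ℕ} {L : ModuleCat.{u} A} (hL : InLm T m L) : FinCores (InAdd T) L := by
  obtain ⟨E, f, d, hw0, hw, hE, hE₀, hf, h₀, hd⟩ := hL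
  exact finCores_of_exact (m + 1) E f d hw0 hw (fun i hi ↦ hE i (by lia))
    (fun i hi ↦ hE₀ i (by lia)) hf h₀ hd

/-- The sequence obtained from `E` by inserting `X` in degree `0`. -/
def ModuleCat.cons (X : ModuleCat.{u} A) (E : ℕ → ModuleCat.{u} A) : ℕ → ModuleCat.{u} A
  | 0 => X
  | i + 1 => E i

open scoped ZeroObject in
lemma InLm.of_inAdd {X : ModuleCat.{u} A} (hX : InAdd T X) : InLm T 0 X := by
  let E : ℕ → ModuleCat.{u} A := .cons X fun _ ↦ 0
  have hE (i : ℕ) : IsZero (E (i + 1)) := isZero_zero _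
  refine ⟨E, 𝟙 X, fun _ ↦ 0, comp_zero, fun i ↦ comp_zero (X := E i), fun i hi ↦ ?_, fun i hi ↦ ?_,
    inferInstanceAs (Mono (𝟙 X)), ?_, fun i ↦ ShortComplex.exact_of_isZero_X₂ _ (hE i)⟩
  · obtain rfl := Nat.le_zero.1 hi
    exact hX
  · obtain ⟨j, rfl⟩ := Nat.exists_eq_succ_of_ne_zero hi.ne'
    exact hE j
  · rw [ShortComplex.exact_iff_epi _ rfl]
    exact inferInstanceAs (Epi (𝟙 X))

lemma InLm.succ_of_shortExact {m : ℕ} {S : ShortComplex (ModuleCat.{u} A)} (hS : S.ShortExact)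
    (h₂ : InAdd T S.X₂) (h₃ : InLm T m S.X₃) : InLm T (m + 1) S.X₁ := by
  obtain ⟨E, f, d, hw0, hw, hE, hE₀, hf, h₀, hd⟩ := h₃
  have := hS.epi_g
  let E' : ℕ → ModuleCat.{u} A := .cons S.X₂ E
  let d' (i : ℕ) : E' i ⟶ E' (i + 1) :=
    match i with
    | 0 => S.g ≫ f
    | i + 1 => d i
  have hw0' : S.f ≫ S.g ≫ f = 0 := by simp
  have hw' (i : ℕ) : d' i ≫ d' (i + 1) = 0 := by
    cases i with
    | zero => exact (Category.assoc _ _ _).trans ((S.g ≫= hw0).trans comp_zero)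
    | succ i => exact hw i
  refine ⟨E', S.f, d', hw0', hw', ?_, ?_, hS.mono_f, ?_, ?_⟩
  · rintro (_ | i) hi
    exacts [h₂, hE i (by lia)]
  · rintro (_ | i) hi
    exacts [absurd hi (by lia), hE₀ i (by lia)]
  · let φ : S ⟶ ShortComplex.mk S.f (S.g ≫ f) hw0' := { τ₁ := 𝟙 _, τ₂ := 𝟙 _, τ₃ := f }
    have : Epi φ.τ₁ := by dsimp [φ]; infer_instance
    have : IsIso φ.τ₂ := by dsimp [φ]; infer_instance
    have : Mono φ.τ₃ := hf
    exact (ShortComplex.exact_iff_of_epi_of_isIso_of_mono φ).1 hS.exact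
  · rintro (_ | i)
    · have hw'' : (S.g ≫ f) ≫ d 0 = 0 := hw' 0
      let φ : ShortComplex.mk (S.g ≫ f) (d 0) hw'' ⟶ ShortComplex.mk f (d 0) hw0 :=
        { τ₁ := S.g, τ₂ := 𝟙 _, τ₃ := 𝟙 _ }
      have : Epi φ.τ₁ := hS.epi_g
      have : IsIso φ.τ₂ := by dsimp [φ]; infer_instance
      have : Mono φ.τ₃ := by dsimp [φ]; infer_instance
      exact (ShortComplex.exact_iff_of_epi_of_isIso_of_mono φ).2 h₀
    · exact hd i

/-- If `Ext^i(T, T^{(I)}) = 0` for all `i > 0`, then a retract `X` of a module with a finite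
`Add(T)`-coresolution has such a coresolution of length `m` as soon as `Ext^i(T, X) = 0` for
all `i > m`. -/
lemma InLm.of_retract_finCores [HasExt.{w} (ModuleCat.{u} A)]
    (hT : ∀ (I : Type u) (i : ℕ), 0 < i → Subsingleton (Ext T (∐ fun _ : I ↦ T) i))
    (m : ℕ) {X L : ModuleCat.{u} A} (hL : FinCores (InAdd T) L) (h : Retract X L)
    (hX : ∀ i : ℕ, m < i → Subsingleton (Ext T X i)) : InLm T m X := by
  have hT' {Y : ModuleCat.{u} A} (hY : InAdd T Y) (i : ℕ) : Subsingleton (Ext T Y (i + 1)) := by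
    obtain ⟨ι, ⟨h⟩⟩ := inAdd_iff.1 hY
    have := hT ι (i + 1) i.succ_pos
    exact h.subsingleton_ext_right T (i + 1)
  have hext (Y Z : ModuleCat.{u} A) (hY : InAdd T Y) (hZ : InAdd T Z) (i : ℕ) :
      Subsingleton (Ext Y Z (i + 1)) := by
    have := hT' hZ i
    exact hY.subsingleton_ext i
  induction m generalizing X L with
  | zero =>
    obtain ⟨S, hS, rfl, L', h₂, hL', ⟨h'⟩⟩ := hL.exists_shortExact_of_retract
      (fun _ ↦ InAdd.of_isZero) (fun _ _ ↦ InAdd.biprod) hext h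
    have := hL'.subsingleton_ext (E := S.X₁) (fun Y hY i ↦ by
      have := hX (i + 1) i.succ_pos
      exact hY.subsingleton_ext i) 0
    have := h'.subsingleton_ext_left S.X₁ 1
    obtain ⟨r, hr⟩ := hS.exists_extension (𝟙 S.X₁)
    exact .of_inAdd (h₂.of_retract ⟨S.f, r, hr⟩)
  | succ m ih =>
    obtain ⟨S, hS, rfl, L', h₂, hL', ⟨h'⟩⟩ := hL.exists_shortExact_of_retract
      (fun _ ↦ InAdd.of_isZero) (fun _ _ ↦ InAdd.biprod) hext h
    refine .succ_of_shortExact hS h₂ (ih hL' h' fun i hi ↦ ?_)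
    have := hX (i + 1) (by lia)
    obtain ⟨j, rfl⟩ := Nat.exists_eq_add_of_lt hi
    have := hT' h₂ (m + j)
    exact hS.subsingleton_ext_X₃_right T _

end InLm

/-- let `A` be a ring and `T` a left `A`-module with (i) projective
dimension at most `n`, (ii) `Ext^i_A(T, T^{(I)}) = 0` for `i > 0` and all sets `I`,
and (3) every module `X` admits an epimorphism `L → X` from some `L ∈ L_n`.
Then the free module `A` has a finite `Add(T)`-coresolution of length `n`,
i.e. `T` is an `n`-tilting module in the classical sense. -/
theorem statement7 (A : Type u) [Ring A] [HasExt.{w} (ModuleCat.{u} A)]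
    (T : ModuleCat.{u} A) (n : ℕ)
    (hi : ∀ (i : ℕ), n < i → ∀ X : ModuleCat.{u} A,
      Subsingleton (Abelian.Ext T X i))
    (hii : ∀ (I : Type u) (i : ℕ), 0 < i →
      Subsingleton (Abelian.Ext T (∐ (fun _ : I => T)) i))
    (h3 : ∀ X : ModuleCat.{u} A, ∃ (L : ModuleCat.{u} A) (g : L ⟶ X),
      InLm T n L ∧ Epi g) :
    InLm T n (ModuleCat.of A A) := by
  obtain ⟨L, g, hL, hg⟩ := h3 (ModuleCat.of A A)
  have : Projective (ModuleCat.of A A) :=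
    (IsProjective.iff_projective (R := A) A).1 inferInstance
  exact .of_retract_finCores hii n hL.finCores
    { i := Projective.factorThru (𝟙 _) g, r := g, retract := Projective.factorThru_comp _ _ }
    fun i hni ↦ hi i hni _
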